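/- arXiv:2512.04575 — 3 statements merged into one kernel-verified Lean document; each statement's English description precedes it below -/
import Mathlib

section
/- Let f : ℝ^n → ℝ be differentiable with gradient ∇f, assume ∇f is pseudo-monotone, and let x* be a point with ∇f(x*) = 0. Let 0 < ν < 1, let β satisfy (1 - √(1 - ν²))/ν² < β ≤ 1, set κ₂ = 2β - 1 - β²ν², and let h_min > 0. Suppose the sequences {x^k}, {z^k} and step sizes {h_k} satisfy, for every k: h_k ≥ h_min, z^k = x^k - h_k∇f(x^k), the line search condition h_k‖∇f(z^k) - ∇f(x^k)‖ ≤ ν‖z^k - x^k‖, and x^{k+1} = x^k - h_k(∇f(x^k) - β(∇f(x^k) - ∇f(z^k))). Then for every positive integer K, (1/K)·Σ_{k=0}^{K-1} ‖∇f(x^k)‖² ≤ ‖x⁰ - x*‖²/(K·κ₂·h_min²). -/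
open scoped RealInnerProductSpace

/-- The contraction factor is positive for relaxation parameters above the smaller root. -/
theorem relaxation_factor_pos {ν β : ℝ} (hν : 0 < ν) (hν1 : ν < 1)
    (hβlo : (1 - Real.sqrt (1 - ν ^ 2)) / ν ^ 2 < β) (hβhi : β ≤ 1) :
    0 < 2 * β - 1 - β ^ 2 * ν ^ 2 := by
  have hν2 : 0 < ν ^ 2 := by positivity
  have hν2' : ν ^ 2 < 1 := by nlinarith
  rw [div_lt_iff₀ hν2] at hβlo
  have hs := Real.sq_sqrt (by linarith : 0 ≤ 1 - ν ^ 2)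
  have hpos : 0 < 1 - β * ν ^ 2 := by nlinarith
  have hmul : 0 < ν ^ 2 * (2 * β - 1 - β ^ 2 * ν ^ 2) := by nlinarith
  exact pos_of_mul_pos_right hmul hν2.le

/-- One relaxed extragradient step decreases the squared distance to `u`. -/
theorem norm_sq_relaxed_step_le {E : Type*} [NormedAddCommGroup E] [InnerProductSpace ℝ E]
    {a b x u : E} {t ν β : ℝ} (ht : 0 < t) (hβ : 0 ≤ β) (hβ1 : β ≤ 1)
    (ha : 0 ≤ ⟪a, x - u⟫) (hb : 0 ≤ ⟪b, x - t • a - u⟫)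
    (hab : ‖b - a‖ ≤ ν * ‖a‖) :
    ‖x - t • (a - β • (a - b)) - u‖ ^ 2 ≤
      ‖x - u‖ ^ 2 - t ^ 2 * (2 * β - 1 - β ^ 2 * ν ^ 2) * ‖a‖ ^ 2 := by
  have hexp : ‖x - t • (a - β • (a - b)) - u‖ ^ 2 =
      ‖x - u‖ ^ 2 - 2 * t * (1 - β) * ⟪a, x - u⟫ - 2 * t * β * ⟪b, x - t • a - u⟫
        + t ^ 2 * ((1 - 2 * β) * ‖a‖ ^ 2 + β ^ 2 * ‖b - a‖ ^ 2) := by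
    have h₁ : x - t • (a - β • (a - b)) - u = (x - u) - (t • (1 - β) • a + t • β • b) := by
      module
    have h₂ : x - t • a - u = (x - u) - t • a := by abel
    rw [h₁, h₂]
    generalize x - u = d
    simp only [← real_inner_self_eq_norm_sq, inner_sub_left, inner_sub_right, inner_add_left,
      inner_add_right, real_inner_smul_left, real_inner_smul_right]
    rw [real_inner_comm a b, real_inner_comm a d, real_inner_comm b d]
    ring
  have hsq : ‖b - a‖ ^ 2 ≤ ν ^ 2 * ‖a‖ ^ 2 := by
    rw [← mul_pow]
    gcongr
  have h₁ : 0 ≤ 2 * t * (1 - β) * ⟪a, x - u⟫ := by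
    have := sub_nonneg.2 hβ1
    positivity
  have h₂ : 0 ≤ 2 * t * β * ⟪b, x - t • a - u⟫ := by positivity
  have h₃ : t ^ 2 * β ^ 2 * ‖b - a‖ ^ 2 ≤ t ^ 2 * β ^ 2 * (ν ^ 2 * ‖a‖ ^ 2) := by gcongr
  rw [hexp]
  linarith

/-- Theorem 3.5: ergodic O(1/K) convergence rate of the squared gradient norms
for Algorithm 2. -/
theorem stmt_9 {n : ℕ} (f : EuclideanSpace ℝ (Fin n) → ℝ)
    (g : EuclideanSpace ℝ (Fin n) → EuclideanSpace ℝ (Fin n))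
    (hdiff : ∀ x, HasGradientAt f (g x) x)
    (hpm : ∀ x y, 0 ≤ ⟪g x, y - x⟫ → 0 ≤ ⟪g y, y - x⟫)
    (xstar : EuclideanSpace ℝ (Fin n)) (hstar : g xstar = 0)
    (ν : ℝ) (hν : 0 < ν) (hν1 : ν < 1)
    (β : ℝ) (hβlo : (1 - Real.sqrt (1 - ν ^ 2)) / ν ^ 2 < β) (hβhi : β ≤ 1)
    (κ₂ : ℝ) (hκ : κ₂ = 2 * β - 1 - β ^ 2 * ν ^ 2)
    (hmin : ℝ) (hhmin : 0 < hmin)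
    (x z : ℕ → EuclideanSpace ℝ (Fin n)) (h : ℕ → ℝ)
    (hhk : ∀ k, hmin ≤ h k)
    (hz : ∀ k, z k = x k - h k • g (x k))
    (hls : ∀ k, h k * ‖g (z k) - g (x k)‖ ≤ ν * ‖z k - x k‖)
    (hx : ∀ k, x (k + 1) = x k - h k • (g (x k) - β • (g (x k) - g (z k))))
    (K : ℕ) (hK : 0 < K) :
    (1 / (K : ℝ)) * ∑ k ∈ Finset.range K, ‖g (x k)‖ ^ 2 ≤
      ‖x 0 - xstar‖ ^ 2 / ((K : ℝ) * κ₂ * hmin ^ 2) := by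
  have hκpos : 0 < κ₂ := hκ ▸ relaxation_factor_pos hν hν1 hβlo hβhi
  have hβ : 0 ≤ β := by nlinarith [sq_nonneg (β * ν)]
  have hmono : ∀ y, 0 ≤ ⟪g y, y - xstar⟫ := fun y => hpm xstar y (by simp [hstar])
  have hstep : ∀ k, hmin ^ 2 * κ₂ * ‖g (x k)‖ ^ 2 ≤
      ‖x k - xstar‖ ^ 2 - ‖x (k + 1) - xstar‖ ^ 2 := by
    intro k
    have hk : 0 < h k := hhmin.trans_le (hhk k)
    have hab : ‖g (z k) - g (x k)‖ ≤ ν * ‖g (x k)‖ := by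
      have hzx : ‖z k - x k‖ = h k * ‖g (x k)‖ := by
        rw [hz k, sub_sub_cancel_left, norm_neg, norm_smul, Real.norm_of_nonneg hk.le]
      have := hls k
      rw [hzx, mul_left_comm] at this
      exact le_of_mul_le_mul_left this hk
    have hb : 0 ≤ ⟪g (z k), x k - h k • g (x k) - xstar⟫ := hz k ▸ hmono (z k)
    have hdec := norm_sq_relaxed_step_le hk hβ hβhi (hmono (x k)) hb hab
    rw [← hx k, ← hκ] at hdec
    have : hmin ^ 2 * κ₂ * ‖g (x k)‖ ^ 2 ≤ h k ^ 2 * κ₂ * ‖g (x k)‖ ^ 2 := by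
      gcongr
      exact hhk k
    linarith
  have hsum : hmin ^ 2 * κ₂ * ∑ k ∈ Finset.range K, ‖g (x k)‖ ^ 2 ≤ ‖x 0 - xstar‖ ^ 2 := by
    rw [Finset.mul_sum]
    refine (Finset.sum_le_sum fun k _ => hstep k).trans ?_
    rw [Finset.sum_range_sub' fun k => ‖x k - xstar‖ ^ 2]
    exact sub_le_self _ (sq_nonneg _)
  have hK' : (0 : ℝ) < K := Nat.cast_pos.2 hK
  rw [le_div_iff₀ (by positivity)]
  calc _ = hmin ^ 2 * κ₂ * ∑ k ∈ Finset.range K, ‖g (x k)‖ ^ 2 := by field_simp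
    _ ≤ _ := hsum
end

section
/- Let f : ℝ^n → ℝ be a differentiable convex function with L-Lipschitz continuous gradient ∇f (L > 0), and let x* be a minimizer of f, so ∇f(x*) = 0. Let 0 ≤ β ≤ 1 and 0 < ν < 1. Given a point x and a step size h > 0 with Lh < 4, let z = x - h∇f(x), assume the line search condition h‖∇f(x) - ∇f(z)‖ ≤ ν‖x - z‖, and define d = h(∇f(x) - β(∇f(x) - ∇f(z))). Then ⟨x - x*, d⟩ ≥ (1 - β)(1 - Lh/4)‖x - z‖² + β⟨x - z, h∇f(z)⟩ ≥ ((1 - β)(1 - Lh/4) + β(1 - ν))‖x - z‖², and the constant (1 - β)(1 - Lh/4) + β(1 - ν) is strictly positive. -/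
open scoped RealInnerProductSpace

section CocoerciveGradient

variable {E : Type*} [NormedAddCommGroup E] [InnerProductSpace ℝ E] [CompleteSpace E]
  {f : E → ℝ} {g : E → E} {L : ℝ}

/-- The descent lemma: a function with `L`-Lipschitz gradient lies below its quadratic model. -/
theorem le_quadratic_of_lipschitz_gradient (hdiff : ∀ x, HasGradientAt f (g x) x)
    (hLip : ∀ x y, ‖g y - g x‖ ≤ L * ‖y - x‖) (x v : E) :
    f (x + v) ≤ f x + ⟪g x, v⟫ + L / 2 * ‖v‖ ^ 2 := by
  have hline (t : ℝ) : HasDerivAt (fun t : ℝ => x + t • v) v t := by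
    simpa using ((hasDerivAt_id t).smul_const v).const_add x
  have hgap (t : ℝ) :
      HasDerivAt (fun t : ℝ => f (x + t • v) - t * ⟪g x, v⟫ - L / 2 * ‖v‖ ^ 2 * t ^ 2)
        (⟪g (x + t • v), v⟫ - ⟪g x, v⟫ - L * t * ‖v‖ ^ 2) t := by
    have hf : HasDerivAt (fun t : ℝ => f (x + t • v)) ⟪g (x + t • v), v⟫ t := by
      simpa [Function.comp_def] using (hdiff (x + t • v)).hasFDerivAt.comp_hasDerivAt t (hline t)
    refine ((hf.sub ((hasDerivAt_id t).mul_const ⟪g x, v⟫)).sub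
      ((hasDerivAt_pow 2 t).const_mul (L / 2 * ‖v‖ ^ 2))).congr_deriv ?_
    push_cast
    ring
  have hanti : AntitoneOn
      (fun t : ℝ => f (x + t • v) - t * ⟪g x, v⟫ - L / 2 * ‖v‖ ^ 2 * t ^ 2) (Set.Ici 0) := by
    refine antitoneOn_of_deriv_nonpos (convex_Ici 0)
      (fun t _ => (hgap t).continuousAt.continuousWithinAt)
      (fun t _ => (hgap t).differentiableAt.differentiableWithinAt) fun t ht => ?_
    have ht0 : 0 ≤ t := interior_subset ht
    rw [(hgap t).deriv, ← inner_sub_left, sub_nonpos]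
    calc ⟪g (x + t • v) - g x, v⟫ ≤ ‖g (x + t • v) - g x‖ * ‖v‖ := real_inner_le_norm _ _
      _ ≤ L * ‖x + t • v - x‖ * ‖v‖ := by gcongr; exact hLip _ _
      _ = L * t * ‖v‖ ^ 2 := by
        rw [add_sub_cancel_left, norm_smul, Real.norm_of_nonneg ht0]
        ring
  have h01 := hanti (Set.mem_Ici.2 le_rfl) (Set.mem_Ici.2 zero_le_one) zero_le_one
  simp only [zero_smul, one_smul, add_zero] at h01
  linarith

/-- A convex function with `L`-Lipschitz gradient lies above its tangents by at least
`‖g y - g x‖ ^ 2 / (2 * L)`. -/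
theorem tangent_add_norm_sq_le_of_lipschitz_gradient (hdiff : ∀ x, HasGradientAt f (g x) x)
    (hconv : ∀ x y, f x + ⟪g x, y - x⟫ ≤ f y) (hL : 0 < L)
    (hLip : ∀ x y, ‖g y - g x‖ ≤ L * ‖y - x‖) (x y : E) :
    f x + ⟪g x, y - x⟫ + ‖g y - g x‖ ^ 2 / (2 * L) ≤ f y := by
  have hup := le_quadratic_of_lipschitz_gradient hdiff hLip y (L⁻¹ • (g x - g y))
  have hlow := hconv x (y + L⁻¹ • (g x - g y))
  have hsq : L⁻¹ * ⟪g x, g x - g y⟫ - L⁻¹ * ⟪g y, g x - g y⟫ = L⁻¹ * ‖g y - g x‖ ^ 2 := by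
    rw [← mul_sub, ← inner_sub_left, real_inner_self_eq_norm_sq, norm_sub_rev]
  have hquad : L / 2 * ‖L⁻¹ • (g x - g y)‖ ^ 2 = ‖g y - g x‖ ^ 2 / (2 * L) := by
    rw [norm_smul, Real.norm_of_nonneg (inv_nonneg.2 hL.le), norm_sub_rev]
    field_simp
  have hhalf : L⁻¹ * ‖g y - g x‖ ^ 2 = 2 * (‖g y - g x‖ ^ 2 / (2 * L)) := by field_simp
  rw [hquad, real_inner_smul_right] at hup
  rw [add_sub_right_comm, inner_add_right, real_inner_smul_right] at hlow
  linarith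

/-- The Baillon–Haddad inequality: an `L`-Lipschitz gradient of a convex function is
`1 / L`-cocoercive. -/
theorem norm_sq_le_inner_of_lipschitz_gradient (hdiff : ∀ x, HasGradientAt f (g x) x)
    (hconv : ∀ x y, f x + ⟪g x, y - x⟫ ≤ f y) (hL : 0 < L)
    (hLip : ∀ x y, ‖g y - g x‖ ≤ L * ‖y - x‖) (x y : E) :
    ‖g x - g y‖ ^ 2 ≤ L * ⟪g x - g y, x - y⟫ := by
  have hxy := tangent_add_norm_sq_le_of_lipschitz_gradient hdiff hconv hL hLip x y
  have hyx := tangent_add_norm_sq_le_of_lipschitz_gradient hdiff hconv hL hLip y x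
  rw [norm_sub_rev, ← neg_sub x y, inner_neg_right] at hxy
  have hsum : ‖g x - g y‖ ^ 2 / L ≤ ⟪g x - g y, x - y⟫ := by
    have hhalf : ‖g x - g y‖ ^ 2 / L = 2 * (‖g x - g y‖ ^ 2 / (2 * L)) := by field_simp
    rw [inner_sub_left]
    linarith
  rwa [div_le_iff₀' hL] at hsum

end CocoerciveGradient

/-- Lemma 3.4: the adjusted direction d = h(∇f(x) - β(∇f(x) - ∇f(z))) is a descent
direction for the distance-to-solution function ½‖x - x*‖². -/
theorem stmt_12 {n : ℕ} (f : EuclideanSpace ℝ (Fin n) → ℝ)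
    (g : EuclideanSpace ℝ (Fin n) → EuclideanSpace ℝ (Fin n))
    (hdiff : ∀ x, HasGradientAt f (g x) x)
    (hconv : ∀ x y, f x + ⟪g x, y - x⟫ ≤ f y)
    (L : ℝ) (hL : 0 < L)
    (hLip : ∀ x y, ‖g y - g x‖ ≤ L * ‖y - x‖)
    (xstar : EuclideanSpace ℝ (Fin n)) (hmin : ∀ y, f xstar ≤ f y)
    (hstar : g xstar = 0)
    (β ν : ℝ) (hβ0 : 0 ≤ β) (hβ1 : β ≤ 1) (hν : 0 < ν) (hν1 : ν < 1)
    (x z d : EuclideanSpace ℝ (Fin n)) (h : ℝ) (hh : 0 < h) (hLh : L * h < 4)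
    (hz : z = x - h • g x)
    (hls : h * ‖g x - g z‖ ≤ ν * ‖x - z‖)
    (hd : d = h • (g x - β • (g x - g z))) :
    ((1 - β) * (1 - L * h / 4) + β * (1 - ν)) * ‖x - z‖ ^ 2 ≤
        (1 - β) * (1 - L * h / 4) * ‖x - z‖ ^ 2 + β * ⟪x - z, h • g z⟫ ∧
      (1 - β) * (1 - L * h / 4) * ‖x - z‖ ^ 2 + β * ⟪x - z, h • g z⟫ ≤ ⟪x - xstar, d⟫ ∧
      0 < (1 - β) * (1 - L * h / 4) + β * (1 - ν) := by
  have hstep : x - z = h • g x := by rw [hz, sub_sub_cancel]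
  have hgradz : (1 - ν) * ‖x - z‖ ^ 2 ≤ ⟪x - z, h • g z⟫ := by
    have hsplit : h • g z = (x - z) - h • (g x - g z) := by rw [hstep, smul_sub, sub_sub_cancel]
    have hcs : ⟪x - z, h • (g x - g z)⟫ ≤ ‖x - z‖ * (ν * ‖x - z‖) := by
      refine (real_inner_le_norm _ _).trans ?_
      rw [norm_smul, Real.norm_of_nonneg hh.le]
      gcongr
    rw [hsplit, inner_sub_right, real_inner_self_eq_norm_sq]
    linarith
  have hgradx : (1 - L * h / 4) * ‖x - z‖ ^ 2 ≤ ⟪x - xstar, h • g x⟫ := by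
    have hcoc := norm_sq_le_inner_of_lipschitz_gradient hdiff hconv hL hLip x xstar
    rw [hstar, sub_zero, real_inner_comm] at hcoc
    rw [hstep, norm_smul, Real.norm_of_nonneg hh.le, real_inner_smul_right]
    refine le_of_mul_le_mul_left ?_ (mul_pos hL hh)
    calc L * h * ((1 - L * h / 4) * (h * ‖g x‖) ^ 2)
        = h ^ 2 * ‖g x‖ ^ 2 - (L * h / 2 - 1) ^ 2 * (h * ‖g x‖) ^ 2 := by ring
      _ ≤ h ^ 2 * ‖g x‖ ^ 2 := sub_le_self _ (by positivity)
      _ ≤ h ^ 2 * (L * ⟪x - xstar, g x⟫) := by gcongr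
      _ = L * h * (h * ⟪x - xstar, g x⟫) := by ring
  have hmono : ⟪x - z, h • g z⟫ ≤ ⟪x - xstar, h • g z⟫ := by
    have hz0 : 0 ≤ ⟪z - xstar, g z⟫ := by
      have hcz := hconv z xstar
      rw [← neg_sub z xstar, inner_neg_right, real_inner_comm] at hcz
      linarith [hmin z]
    rw [← sub_add_sub_cancel x z xstar, inner_add_left, real_inner_smul_right (z - xstar)]
    exact le_add_of_nonneg_right (mul_nonneg hh.le hz0)
  have hd' : d = (1 - β) • h • g x + β • h • g z := by rw [hd]; module
  refine ⟨?_, ?_, ?_⟩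
  · linarith [mul_le_mul_of_nonneg_left hgradz hβ0]
  · rw [hd', inner_add_right, real_inner_smul_right _ (h • g x), real_inner_smul_right _ (h • g z),
      mul_assoc]
    exact add_le_add (mul_le_mul_of_nonneg_left hgradx (sub_nonneg.2 hβ1))
      (mul_le_mul_of_nonneg_left hmono hβ0)
  · have hstepsize : 0 < 1 - L * h / 4 := by linarith
    rcases hβ0.eq_or_lt with rfl | hβ
    · simpa using hstepsize
    · exact add_pos_of_nonneg_of_pos (mul_nonneg (sub_nonneg.2 hβ1) hstepsize.le)
        (mul_pos hβ (sub_pos.2 hν1))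
end

section
/- Let f : ℝ^n → ℝ be a differentiable convex function with L-Lipschitz continuous gradient ∇f (L > 0), and let x* be a minimizer of f, so ∇f(x*) = 0. Let 0 ≤ β ≤ 1, 0 < ν < 1, η ∈ (0,2), 0 < h̄ < 4/L, and h_min > 0; set α_min = ((1 - β)(1 - Lh̄/4) + β(1 - ν))/(2 + 2β²ν²) and κ₄ = η(2 - η)·α_min·((1 - β)(1 - Lh̄/4) + β(1 - ν)). Suppose the sequences {x^k}, {z^k} and step sizes {h_k} satisfy, for every k: ∇f(x^k) ≠ 0, h_min ≤ h_k ≤ h̄, z^k = x^k - h_k∇f(x^k), the line search condition h_k‖∇f(x^k) - ∇f(z^k)‖ ≤ ν‖x^k - z^k‖, and x^{k+1} = x^k - ηα_k h_k(∇f(x^k) - β(∇f(x^k) - ∇f(z^k))), where α_k = ((1 - β)(1 - Lh_k/4)‖x^k - z^k‖² + β⟨x^k - z^k, h_k∇f(z^k)⟩)/(h_k²‖∇f(x^k) - β(∇f(x^k) - ∇f(z^k))‖²). Then for every positive integer K, (1/K)·Σ_{k=0}^{K-1} ‖∇f(x^k)‖² ≤ ‖x⁰ - x*‖²/(K·κ₄·h_min²).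 -/
open scoped RealInnerProductSpace

section SmoothConvex

variable {E : Type*} [NormedAddCommGroup E] [InnerProductSpace ℝ E]

/-- The descent lemma: a function with `L`-Lipschitz gradient lies below its quadratic upper
model. -/
lemma le_add_inner_add_sq_of_lipschitz_gradient [CompleteSpace E] {f : E → ℝ} {g : E → E} {L : ℝ}
    (hdiff : ∀ x, HasGradientAt f (g x) x) (hLip : ∀ x y, ‖g y - g x‖ ≤ L * ‖y - x‖) (x y : E) :
    f y ≤ f x + ⟪g x, y - x⟫ + L / 2 * ‖y - x‖ ^ 2 := by
  set v := y - x with hv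
  let φ : ℝ → ℝ := fun t => f (x + t • v) - t * ⟪g x, v⟫ - L / 2 * t ^ 2 * ‖v‖ ^ 2
  have hφ (t : ℝ) : HasDerivAt φ (⟪g (x + t • v), v⟫ - ⟪g x, v⟫ - L * t * ‖v‖ ^ 2) t := by
    have hline : HasDerivAt (fun s : ℝ => x + s • v) v t := by
      simpa using ((hasDerivAt_id t).smul_const v).const_add x
    have hf : HasDerivAt (fun s : ℝ => f (x + s • v)) ⟪g (x + t • v), v⟫ t := by
      have hcomp := (hdiff (x + t • v)).hasFDerivAt.comp_hasDerivAt t hline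
      rwa [InnerProductSpace.toDual_apply_apply] at hcomp
    have hq := ((hasDerivAt_pow 2 t).const_mul (L / 2)).mul_const (‖v‖ ^ 2)
    refine ((hf.sub ((hasDerivAt_id t).mul_const ⟪g x, v⟫)).sub hq).congr_deriv ?_
    push_cast
    ring
  have hanti : AntitoneOn φ (Set.Icc 0 1) := by
    refine antitoneOn_of_deriv_nonpos (convex_Icc 0 1)
      (fun t _ => (hφ t).continuousAt.continuousWithinAt)
      (fun t _ => (hφ t).differentiableAt.differentiableWithinAt) fun t ht => ?_
    rw [interior_Icc] at ht
    rw [(hφ t).deriv, ← inner_sub_left]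
    have h1 := real_inner_le_norm (g (x + t • v) - g x) v
    have h2 := hLip x (x + t • v)
    rw [add_sub_cancel_left, norm_smul, Real.norm_of_nonneg ht.1.le] at h2
    nlinarith [mul_le_mul_of_nonneg_right h2 (norm_nonneg v)]
  have h01 := hanti (Set.left_mem_Icc.2 zero_le_one) (Set.right_mem_Icc.2 zero_le_one) zero_le_one
  simp only [φ, one_smul, zero_smul, add_zero] at h01
  rw [hv, add_sub_cancel, ← hv] at h01
  linarith

/-- Cocoercivity of the gradient of a smooth convex function, relative to a minimizer. -/
lemma norm_gradient_sq_le_mul_inner_sub_minimizer [CompleteSpace E] {f : E → ℝ} {g : E → E} {L : ℝ}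
    (hdiff : ∀ x, HasGradientAt f (g x) x) (hconv : ∀ x y, f x + ⟪g x, y - x⟫ ≤ f y) (hL : 0 < L)
    (hLip : ∀ x y, ‖g y - g x‖ ≤ L * ‖y - x‖) {xstar : E} (hmin : ∀ y, f xstar ≤ f y)
    (hstar : g xstar = 0) (x : E) :
    ‖g x‖ ^ 2 ≤ L * ⟪x - xstar, g x⟫ := by
  have h1 := le_add_inner_add_sq_of_lipschitz_gradient hdiff hLip xstar (xstar + L⁻¹ • g x)
  have h2 := hconv x (xstar + L⁻¹ • g x)
  have h3 := le_add_inner_add_sq_of_lipschitz_gradient hdiff hLip x (x - L⁻¹ • g x)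
  have h4 := hmin (x - L⁻¹ • g x)
  have hnorm : ‖L⁻¹ • g x‖ ^ 2 = L⁻¹ ^ 2 * ‖g x‖ ^ 2 := by
    rw [norm_smul, mul_pow, Real.norm_eq_abs, sq_abs]
  rw [add_sub_cancel_left, hstar, inner_zero_left, hnorm] at h1
  rw [show xstar + L⁻¹ • g x - x = L⁻¹ • g x - (x - xstar) by abel, inner_sub_right,
    real_inner_smul_right, real_inner_self_eq_norm_sq, real_inner_comm] at h2
  rw [show x - L⁻¹ • g x - x = -(L⁻¹ • g x) by abel, inner_neg_right, norm_neg, hnorm,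
    real_inner_smul_right, real_inner_self_eq_norm_sq] at h3
  have hsq : L / 2 * (L⁻¹ ^ 2 * ‖g x‖ ^ 2) = L⁻¹ * ‖g x‖ ^ 2 / 2 := by
    field_simp
  rw [hsq] at h1 h3
  have h5 : L⁻¹ * ‖g x‖ ^ 2 ≤ ⟪x - xstar, g x⟫ := by linarith
  rwa [inv_mul_le_iff₀ hL] at h5

/-- A relaxed projection step along `d` decreases the squared distance to every point `p` with
`N ≤ ⟪x - p, d⟫` by at least `η (2 - η) α N`, where `α = N / ‖d‖ ^ 2`. -/
lemma norm_sub_sq_add_le_of_relaxed_projection_step {x p d : E} {N α η : ℝ}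
    (hN : N ≤ ⟪x - p, d⟫) (hαd : α * ‖d‖ ^ 2 = N) (hα : 0 ≤ α) (hη : 0 ≤ η) :
    ‖x - (η * α) • d - p‖ ^ 2 + η * (2 - η) * α * N ≤ ‖x - p‖ ^ 2 := by
  rw [sub_right_comm, norm_sub_sq_real, real_inner_smul_right, norm_smul, mul_pow,
    Real.norm_eq_abs, sq_abs]
  have h1 : (η * α) ^ 2 * ‖d‖ ^ 2 = η ^ 2 * α * N := by rw [← hαd]; ring
  rw [h1]
  nlinarith [mul_le_mul_of_nonneg_left hN (mul_nonneg hη hα)]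

/-- One step of the method decreases the squared distance to a minimizer by at least a fixed
multiple of the squared residual `‖h • g x‖ ^ 2`. -/
lemma norm_sub_minimizer_sq_add_le [CompleteSpace E] {f : E → ℝ} {g : E → E} {L : ℝ}
    (hdiff : ∀ x, HasGradientAt f (g x) x) (hconv : ∀ x y, f x + ⟪g x, y - x⟫ ≤ f y) (hL : 0 < L)
    (hLip : ∀ x y, ‖g y - g x‖ ≤ L * ‖y - x‖) {xstar : E} (hmin : ∀ y, f xstar ≤ f y)
    (hstar : g xstar = 0) {β ν η c h hbar α : ℝ} (hβ0 : 0 ≤ β) (hβ1 : β ≤ 1)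
    (hη0 : 0 < η) (hη2 : η < 2) (hh : 0 < h) (hhbar : h ≤ hbar)
    (hc : c = (1 - β) * (1 - L * hbar / 4) + β * (1 - ν)) (hc0 : 0 < c) {x z : E}
    (hne : g x ≠ 0) (hz : z = x - h • g x) (hls : h * ‖g x - g z‖ ≤ ν * ‖x - z‖)
    (hα : α = ((1 - β) * (1 - L * h / 4) * ‖x - z‖ ^ 2 + β * ⟪x - z, h • g z⟫) /
        (h ^ 2 * ‖g x - β • (g x - g z)‖ ^ 2)) :
    ‖x - (η * α * h) • (g x - β • (g x - g z)) - xstar‖ ^ 2 +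
        η * (2 - η) * (c / (2 + 2 * β ^ 2 * ν ^ 2)) * c * (h ^ 2 * ‖g x‖ ^ 2) ≤
      ‖x - xstar‖ ^ 2 := by
  set N := (1 - β) * (1 - L * h / 4) * ‖x - z‖ ^ 2 + β * ⟪x - z, h • g z⟫ with hNdef
  set d := g x - β • (g x - g z) with hd
  have hxz : x - z = h • g x := by rw [hz]; abel
  have hr : ‖x - z‖ ^ 2 = h ^ 2 * ‖g x‖ ^ 2 := by
    rw [hxz, norm_smul, mul_pow, Real.norm_eq_abs, sq_abs]
  have hgpos : 0 < ‖g x‖ ^ 2 := by have := norm_pos_iff.2 hne; positivity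
  have hrpos : 0 < ‖x - z‖ ^ 2 := by rw [hr]; positivity
  have hhd : h • d = (x - z) - β • (h • (g x - g z)) := by
    rw [hd, hxz, smul_sub, smul_comm h β]
  have hhd' : h • d = (1 - β) • (h • g x) + β • (h • g z) := by rw [hd]; module
  have hnd : ‖h • d‖ ^ 2 = h ^ 2 * ‖d‖ ^ 2 := by
    rw [norm_smul, mul_pow, Real.norm_eq_abs, sq_abs]
  have hw : ‖h • (g x - g z)‖ ≤ ν * ‖x - z‖ := by
    rwa [norm_smul, Real.norm_of_nonneg hh.le]
  have hNlower : c * ‖x - z‖ ^ 2 ≤ N := by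
    have hcs := real_inner_le_norm (x - z) (h • (g x - g z))
    have hmul := mul_le_mul_of_nonneg_left hw (norm_nonneg (x - z))
    have hinner : ⟪x - z, h • (g x - g z)⟫ = ‖x - z‖ ^ 2 - ⟪x - z, h • g z⟫ := by
      rw [smul_sub, ← hxz, inner_sub_right, real_inner_self_eq_norm_sq]
    have h1 : (1 - ν) * ‖x - z‖ ^ 2 ≤ ⟪x - z, h • g z⟫ := by nlinarith
    have h2 : 1 - L * hbar / 4 ≤ 1 - L * h / 4 := by nlinarith
    have h3 := mul_le_mul_of_nonneg_right
      (mul_le_mul_of_nonneg_left h2 (sub_nonneg.2 hβ1)) hrpos.le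
    have h4 := mul_le_mul_of_nonneg_left h1 hβ0
    rw [hNdef, hc]
    linarith
  have hNupper : N ≤ ⟪x - xstar, h • d⟫ := by
    have hco := norm_gradient_sq_le_mul_inner_sub_minimizer hdiff hconv hL hLip hmin hstar x
    have h1 : (1 - L * h / 4) * ‖x - z‖ ^ 2 ≤ h * ⟪x - xstar, g x⟫ := by
      have hbound : L * ((1 - L * h / 4) * (h ^ 2 * ‖g x‖ ^ 2)) ≤ L * (h * ⟪x - xstar, g x⟫) := by
        have hs : L * h * (1 - L * h / 4) ≤ 1 := by nlinarith [sq_nonneg (1 - L * h / 2)]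
        have := mul_le_mul_of_nonneg_right hs (mul_nonneg hh.le hgpos.le)
        nlinarith [mul_le_mul_of_nonneg_left hco hh.le]
      rw [hr]
      exact le_of_mul_le_mul_left hbound hL
    have h2 : ⟪x - z, g z⟫ ≤ ⟪x - xstar, g z⟫ := by
      have h3 := hconv z xstar
      have h4 := hmin z
      rw [real_inner_comm] at h3
      have h5 : ⟪x - xstar, g z⟫ = ⟪x - z, g z⟫ - ⟪xstar - z, g z⟫ := by
        rw [← inner_sub_left]; congr 1; abel
      linarith
    rw [hNdef, hhd', inner_add_right]
    simp only [real_inner_smul_right]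
    have h3 := mul_le_mul_of_nonneg_left h1 (sub_nonneg.2 hβ1)
    have h4 := mul_le_mul_of_nonneg_left (mul_le_mul_of_nonneg_left h2 hh.le) hβ0
    linarith
  have hNpos : 0 < N := lt_of_lt_of_le (mul_pos hc0 hrpos) hNlower
  have hhd0 : h • d ≠ 0 := fun h0 => by
    rw [h0, inner_zero_right] at hNupper
    exact absurd hNupper hNpos.not_ge
  have hdpos : 0 < ‖h • d‖ ^ 2 := by have := norm_pos_iff.2 hhd0; positivity
  rw [← hnd] at hα
  have hdupper : ‖h • d‖ ^ 2 ≤ (2 + 2 * β ^ 2 * ν ^ 2) * ‖x - z‖ ^ 2 := by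
    have h1 : ‖h • d‖ ≤ ‖x - z‖ + β * (ν * ‖x - z‖) := by
      rw [hhd]
      refine (norm_sub_le _ _).trans ?_
      rw [norm_smul β, Real.norm_of_nonneg hβ0]
      gcongr
    have h2 := pow_le_pow_left₀ (norm_nonneg _) h1 2
    nlinarith [sq_nonneg (‖x - z‖ - β * (ν * ‖x - z‖))]
  have hαlower : c / (2 + 2 * β ^ 2 * ν ^ 2) ≤ α := by
    rw [hα, div_le_div_iff₀ (by positivity) hdpos]
    calc c * ‖h • d‖ ^ 2 ≤ c * ((2 + 2 * β ^ 2 * ν ^ 2) * ‖x - z‖ ^ 2) := by gcongr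
      _ = c * ‖x - z‖ ^ 2 * (2 + 2 * β ^ 2 * ν ^ 2) := by ring
      _ ≤ N * (2 + 2 * β ^ 2 * ν ^ 2) := by gcongr
  have hα0 : 0 ≤ α := le_trans (by positivity) hαlower
  have hstep := norm_sub_sq_add_le_of_relaxed_projection_step (x := x) (p := xstar) hNupper
    (by rw [hα, div_mul_cancel₀ _ hdpos.ne']) hα0 hη0.le
  rw [smul_smul] at hstep
  refine le_trans ?_ hstep
  have hη : 0 ≤ η * (2 - η) := mul_nonneg hη0.le (sub_nonneg.2 hη2.le)
  rw [← hr, mul_assoc (η * (2 - η) * _)]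
  gcongr

end SmoothConvex

/-- Theorem 3.6: ergodic O(1/K) convergence rate of the squared gradient norms
for Algorithm 3. -/
theorem stmt_16 {n : ℕ} (f : EuclideanSpace ℝ (Fin n) → ℝ)
    (g : EuclideanSpace ℝ (Fin n) → EuclideanSpace ℝ (Fin n))
    (hdiff : ∀ x, HasGradientAt f (g x) x)
    (hconv : ∀ x y, f x + ⟪g x, y - x⟫ ≤ f y)
    (L : ℝ) (hL : 0 < L)
    (hLip : ∀ x y, ‖g y - g x‖ ≤ L * ‖y - x‖)
    (xstar : EuclideanSpace ℝ (Fin n)) (hminpt : ∀ y, f xstar ≤ f y)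
    (hstar : g xstar = 0)
    (β ν η hbar hmin : ℝ) (hβ0 : 0 ≤ β) (hβ1 : β ≤ 1) (hν : 0 < ν) (hν1 : ν < 1)
    (hη0 : 0 < η) (hη2 : η < 2) (hbar0 : 0 < hbar) (hbarL : hbar < 4 / L)
    (hhmin : 0 < hmin)
    (αmin κ₄ : ℝ)
    (hαmin : αmin = ((1 - β) * (1 - L * hbar / 4) + β * (1 - ν)) / (2 + 2 * β ^ 2 * ν ^ 2))
    (hκ : κ₄ = η * (2 - η) * αmin * ((1 - β) * (1 - L * hbar / 4) + β * (1 - ν)))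
    (x z : ℕ → EuclideanSpace ℝ (Fin n)) (h α : ℕ → ℝ)
    (hne : ∀ k, g (x k) ≠ 0)
    (hhk : ∀ k, hmin ≤ h k) (hhk' : ∀ k, h k ≤ hbar)
    (hz : ∀ k, z k = x k - h k • g (x k))
    (hls : ∀ k, h k * ‖g (x k) - g (z k)‖ ≤ ν * ‖x k - z k‖)
    (hα : ∀ k, α k = ((1 - β) * (1 - L * h k / 4) * ‖x k - z k‖ ^ 2
          + β * ⟪x k - z k, h k • g (z k)⟫) /
        (h k ^ 2 * ‖g (x k) - β • (g (x k) - g (z k))‖ ^ 2))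
    (hx : ∀ k, x (k + 1) = x k - (η * α k * h k) • (g (x k) - β • (g (x k) - g (z k))))
    (K : ℕ) (hK : 0 < K) :
    (1 / (K : ℝ)) * ∑ k ∈ Finset.range K, ‖g (x k)‖ ^ 2 ≤
      ‖x 0 - xstar‖ ^ 2 / ((K : ℝ) * κ₄ * hmin ^ 2) := by
  set c := (1 - β) * (1 - L * hbar / 4) + β * (1 - ν) with hc
  have hLh : 0 < 1 - L * hbar / 4 := by
    rw [lt_div_iff₀ hL] at hbarL
    linarith
  have hc0 : 0 < c := by
    rcases hβ1.lt_or_eq with hβ | hβ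
    · exact add_pos_of_pos_of_nonneg (mul_pos (sub_pos.2 hβ) hLh)
        (mul_nonneg hβ0 (sub_nonneg.2 hν1.le))
    · rw [hc, hβ]
      linarith
  have hκ0 : 0 < κ₄ := by
    have := sub_pos.2 hη2
    rw [hκ, hαmin]
    positivity
  have hstep (k : ℕ) :
      κ₄ * hmin ^ 2 * ‖g (x k)‖ ^ 2 ≤ ‖x k - xstar‖ ^ 2 - ‖x (k + 1) - xstar‖ ^ 2 := by
    have hdec := norm_sub_minimizer_sq_add_le hdiff hconv hL hLip hminpt hstar hβ0 hβ1 hη0 hη2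
      (hhmin.trans_le (hhk k)) (hhk' k) hc hc0 (hne k) (hz k) (hls k) (hα k)
    rw [← hx, ← hαmin, ← hκ] at hdec
    have hsq : κ₄ * hmin ^ 2 * ‖g (x k)‖ ^ 2 ≤ κ₄ * (h k ^ 2 * ‖g (x k)‖ ^ 2) := by
      rw [mul_assoc]
      gcongr
      exact hhk k
    linarith
  have hsum : κ₄ * hmin ^ 2 * ∑ k ∈ Finset.range K, ‖g (x k)‖ ^ 2 ≤ ‖x 0 - xstar‖ ^ 2 := by
    rw [Finset.mul_sum]
    refine (Finset.sum_le_sum fun k _ => hstep k).trans ?_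
    rw [Finset.sum_range_sub' fun k => ‖x k - xstar‖ ^ 2]
    exact sub_le_self _ (sq_nonneg _)
  have hK0 : (0 : ℝ) < K := Nat.cast_pos.2 hK
  rw [le_div_iff₀ (by positivity)]
  refine le_trans (le_of_eq ?_) hsum
  field_simp
end
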